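/- arXiv:2603.19447 — 2 statements merged into one kernel-verified Lean document; each statement's English description precedes it below -/
import Mathlib

section
/- Let d ≥ 1 and Δ ≥ 0 be integers, G a graph on vertex set [n] whose complement Ḡ has maximum degree at most Δ, and M a G-partial matrix. Suppose: (i) X ⊆ [n] is a clique of G and M[X] is d-embeddable; (ii) for every v ∈ [n] \ X, M[C_v] is d-embeddable, where C_v = {v} ∪ (N_G(v) ∩ X); (iii) X₁,…,X_{Δ+1} ⊆ X are pairwise disjoint and for each i ∈ {1,…,Δ+1} the set X_i is a d-metric basis of M[X \ (X₁ ∪ … ∪ X_{i−1})]; (iv) w ∈ X \ (X₁ ∪ … ∪ X_{Δ+1}). Then M is d-completable if and only if M − w is d-completable. -/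
/-- `M` is a `G`-partial matrix: the specified entries (those indexed by edges of `G`)
are symmetric and nonnegative, and the diagonal is zero.  Entries at non-edges are
unspecified (their values are irrelevant). -/
def IsPartialMatrix {V : Type*} (G : SimpleGraph V) (M : V → V → ℝ) : Prop :=
  (∀ i j, G.Adj i j → M i j = M j i) ∧ (∀ i j, G.Adj i j → 0 ≤ M i j) ∧
    (∀ i, M i i = 0)

/-- `q` is a realization of the principal submatrix `M[S]` in `ℝ^d`. -/
def IsRealizationOn {V : Type*} (d : ℕ) (M : V → V → ℝ) (S : Set V)
    (q : V → EuclideanSpace ℝ (Fin d)) : Prop :=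
  ∀ u ∈ S, ∀ v ∈ S, dist (q u) (q v) ^ 2 = M u v

/-- The principal submatrix `M[S]` is `d`-embeddable. -/
def IsEmbeddableOn {V : Type*} (d : ℕ) (M : V → V → ℝ) (S : Set V) : Prop :=
  ∃ q : V → EuclideanSpace ℝ (Fin d), IsRealizationOn d M S q

/-- `B` is a `d`-metric basis of `M[S]`: `M[S]` is `d`-embeddable and in every
realization of `M[S]` in `ℝ^d` the points indexed by `B` are affinely independent and
every point of the realization lies in their affine span. -/
def IsMetricBasisOn {V : Type*} (d : ℕ) (M : V → V → ℝ) (S B : Set V) : Prop :=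
  B ⊆ S ∧ IsEmbeddableOn d M S ∧
    ∀ q : V → EuclideanSpace ℝ (Fin d), IsRealizationOn d M S q →
      AffineIndependent ℝ (fun b : B => q ↑b) ∧
      ∀ v ∈ S, q v ∈ affineSpan ℝ (q '' B)

/-- The `G`-partial matrix `M`, restricted to the vertex set `S`, is `d`-completable:
there are points in `ℝ^d`, one per vertex, realizing all specified entries between
vertices of `S`. -/
def IsCompletableOn {V : Type*} (d : ℕ) (G : SimpleGraph V) (M : V → V → ℝ)
    (S : Set V) : Prop :=
  ∃ p : V → EuclideanSpace ℝ (Fin d), ∀ u ∈ S, ∀ v ∈ S, G.Adj u v →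
    dist (p u) (p v) ^ 2 = M u v

/-- The `G`-partial matrix `M` is `d`-completable. -/
def IsCompletable {V : Type*} (d : ℕ) (G : SimpleGraph V) (M : V → V → ℝ) : Prop :=
  IsCompletableOn d G M Set.univ

/-- Two families of vectors with the same Gram matrix differ by a linear isometry. -/
lemma exists_linearIsometry_of_inner_eq {ι E : Type*} [NormedAddCommGroup E]
    [InnerProductSpace ℝ E] [FiniteDimensional ℝ E] (f g : ι → E)
    (h : ∀ i j, inner ℝ (f i) (f j) = inner ℝ (g i) (g j)) :
    ∃ φ : E →ₗᵢ[ℝ] E, ∀ i, φ (f i) = g i := by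
  set L := Finsupp.linearCombination ℝ f
  set L' := Finsupp.linearCombination ℝ g
  have hnorm : ∀ c, ‖L' c‖ = ‖L c‖ := fun c ↦ by
    have hinner : inner ℝ (L' c) (L' c) = inner ℝ (L c) (L c) := by
      simp only [L, L', Finsupp.linearCombination_apply, Finsupp.sum, inner_sum, sum_inner,
        inner_smul_left, inner_smul_right, h]
    rw [real_inner_self_eq_norm_sq, real_inner_self_eq_norm_sq] at hinner
    exact (sq_eq_sq₀ (norm_nonneg _) (norm_nonneg _)).1 hinner
  obtain ⟨s, hs⟩ := L.rangeRestrict.exists_rightInverse_of_surjective L.range_rangeRestrict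
  have hs' : ∀ y, L (s y) = y := fun y ↦ congrArg Subtype.val (LinearMap.congr_fun hs y)
  let φ : LinearMap.range L →ₗᵢ[ℝ] E := ⟨L' ∘ₗ s, fun y ↦ by
    rw [LinearMap.comp_apply, hnorm, hs', Submodule.coe_norm]⟩
  refine ⟨φ.extend, fun i ↦ ?_⟩
  have hf : L (Finsupp.single i 1) = f i := by simp [L]
  have hg : L' (Finsupp.single i 1) = g i := by simp [L']
  have hmem : f i ∈ LinearMap.range L := ⟨_, hf⟩
  have hext : φ.extend (f i) = L' (s ⟨f i, hmem⟩) := φ.extend_apply ⟨f i, hmem⟩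
  rw [hext, ← sub_eq_zero, ← norm_eq_zero, ← hg, ← map_sub, hnorm, map_sub, hs', hf, sub_self,
    norm_zero]

/-- Two families of points with the same mutual distances differ by an isometry of the space. -/
lemma exists_isometry_of_dist_eq {V E : Type*} [NormedAddCommGroup E]
    [InnerProductSpace ℝ E] [FiniteDimensional ℝ E] (S : Set V) (f g : V → E)
    (h : ∀ u ∈ S, ∀ v ∈ S, dist (f u) (f v) = dist (g u) (g v)) :
    ∃ T : E → E, Isometry T ∧ ∀ u ∈ S, T (f u) = g u := by
  rcases S.eq_empty_or_nonempty with rfl | ⟨a, ha⟩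
  · exact ⟨id, isometry_id, by simp⟩
  obtain ⟨φ, hφ⟩ := exists_linearIsometry_of_inner_eq (fun u : S ↦ f u - f a)
    (fun u : S ↦ g u - g a) fun u v ↦ by
      simp only [real_inner_eq_norm_mul_self_add_norm_mul_self_sub_norm_sub_mul_self_div_two,
        sub_sub_sub_cancel_right, ← dist_eq_norm, h _ u.2 _ ha, h _ v.2 _ ha, h _ u.2 _ v.2]
  refine ⟨fun x ↦ φ (x - f a) + g a, Isometry.of_dist_eq fun x y ↦ ?_, fun u hu ↦ ?_⟩
  · rw [dist_add_right, φ.dist_map, dist_sub_right]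
  · simp only [hφ ⟨u, hu⟩, sub_add_cancel]

lemma IsRealizationOn.mono {V : Type*} {d : ℕ} {M : V → V → ℝ} {S T : Set V}
    {q : V → EuclideanSpace ℝ (Fin d)} (hq : IsRealizationOn d M T q) (hST : S ⊆ T) :
    IsRealizationOn d M S q :=
  fun u hu v hv ↦ hq u (hST hu) v (hST hv)

/-- Two realizations of the same matrix differ by an isometry of the space. -/
lemma IsRealizationOn.exists_isometry {V : Type*} {d : ℕ} {M : V → V → ℝ} {S : Set V}
    {q r : V → EuclideanSpace ℝ (Fin d)} (hq : IsRealizationOn d M S q)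
    (hr : IsRealizationOn d M S r) :
    ∃ T : EuclideanSpace ℝ (Fin d) → EuclideanSpace ℝ (Fin d),
      Isometry T ∧ ∀ u ∈ S, T (q u) = r u :=
  exists_isometry_of_dist_eq S q r fun u hu v hv ↦
    (sq_eq_sq₀ dist_nonneg dist_nonneg).1 ((hq u hu v hv).trans (hr u hu v hv).symm)

/-- If `p w` lies in the affine span of `p '' B`, the distance from `p v` to `p w` is determined
by the distances from `p v` to `p '' B`. -/
lemma dist_sq_eq_of_mem_affineSpan {V : Type*} {d : ℕ} {M : V → V → ℝ} {B : Set V} {v w : V}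
    {p : V → EuclideanSpace ℝ (Fin d)} (hp : IsRealizationOn d M (insert w B) p)
    (hemb : IsEmbeddableOn d M (insert v (insert w B)))
    (hv : ∀ b ∈ B, dist (p b) (p v) ^ 2 = M b v) (hw : p w ∈ affineSpan ℝ (p '' B)) :
    dist (p w) (p v) ^ 2 = M w v := by
  obtain ⟨r, hr⟩ := hemb
  obtain ⟨T, hT, hTr⟩ := (hr.mono (Set.subset_insert v _)).exists_isometry hp
  have hle : affineSpan ℝ (p '' B) ≤ AffineSubspace.perpBisector (p v) (T (r v)) := by
    rw [affineSpan_le]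
    rintro _ ⟨b, hb, rfl⟩
    have hb' : b ∈ insert w B := Set.mem_insert_of_mem w hb
    rw [SetLike.mem_coe, AffineSubspace.mem_perpBisector_iff_dist_eq,
      ← sq_eq_sq₀ dist_nonneg dist_nonneg, hv b hb, ← hTr b hb', hT.dist_eq,
      hr b (Set.mem_insert_of_mem v hb') v (Set.mem_insert v _)]
  have hwT := hle hw
  rw [AffineSubspace.mem_perpBisector_iff_dist_eq] at hwT
  have hw' : w ∈ insert w B := Set.mem_insert w B
  rw [hwT, ← hTr w hw', hT.dist_eq, hr w (Set.mem_insert_of_mem v hw') v (Set.mem_insert v _)]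

/-- Among more than `s.ncard` pairwise disjoint sets, one is disjoint from the finite set `s`. -/
lemma exists_disjoint_of_ncard_lt {α ι : Type*} [Fintype ι] {s : Set α} (hs : s.Finite)
    (A : ι → Set α) (hA : Pairwise (Function.onFun Disjoint A)) (hcard : s.ncard < Fintype.card ι) :
    ∃ i, Disjoint (A i) s := by
  by_contra! hcon
  choose x hxA hxs using fun i ↦ Set.not_disjoint_iff.1 (hcon i)
  have hinj : Function.Injective x := fun i j hij ↦ by
    by_contra hne
    exact Set.disjoint_left.1 (hA hne) (hxA i) (hij ▸ hxA j)
  have hle := Set.ncard_le_ncard (Set.range_subset_iff.2 hxs) hs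
  rw [Set.ncard_range_of_injective hinj, Nat.card_eq_fintype_card] at hle
  omega

/-- Claim 3.5: the irrelevant-vertex claim in the bounded-degree-complement
compression.  Deleting the vertex `w` yields an equivalent instance of `d`-EDM
completion. -/
theorem irrelevant_vertex_maxDegree {n : ℕ} (d Δ : ℕ) (hd : 1 ≤ d)
    (G : SimpleGraph (Fin n))
    (hdeg : ∀ v : Fin n, (Gᶜ.neighborSet v).ncard ≤ Δ)
    (M : Fin n → Fin n → ℝ) (hM : IsPartialMatrix G M)
    (X : Set (Fin n)) (hX : G.IsClique X)
    (hXemb : IsEmbeddableOn d M X)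
    (hCv : ∀ v : Fin n, v ∉ X → IsEmbeddableOn d M ({v} ∪ (G.neighborSet v ∩ X)))
    (Xi : Fin (Δ + 1) → Set (Fin n)) (hXisub : ∀ i, Xi i ⊆ X)
    (hXidisj : Pairwise (Function.onFun Disjoint Xi))
    (hXibasis : ∀ i : Fin (Δ + 1),
      IsMetricBasisOn d M (X \ ⋃ (j : Fin (Δ + 1)) (_ : j < i), Xi j) (Xi i))
    (w : Fin n)
    (hw : w ∈ X \ ⋃ i : Fin (Δ + 1), Xi i) :
    IsCompletable d G M ↔ IsCompletableOn d G M {w}ᶜ := by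
  classical
  refine ⟨fun ⟨p, hp⟩ ↦ ⟨p, fun u _ v _ ↦ hp u trivial v trivial⟩, fun ⟨p, hp⟩ ↦ ?_⟩
  obtain ⟨hwX, hwXi⟩ := hw
  simp only [Set.mem_iUnion, not_exists] at hwXi
  obtain ⟨q, hq⟩ := hXemb
  have hpX : IsRealizationOn d M (X \ {w}) p := fun u hu v hv ↦ by
    rcases eq_or_ne u v with rfl | huv
    · simp [hM.2.2]
    · exact hp u hu.2 v hv.2 (hX hu.1 hv.1 huv)
  obtain ⟨T, hT, hTq⟩ := (hq.mono Set.sdiff_subset).exists_isometry hpX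
  set p' := Function.update p w (T (q w)) with hp'
  have hp'_of_ne : ∀ u, u ≠ w → p' u = p u := fun u hu ↦ Function.update_of_ne hu _ _
  have hp'_eq : ∀ u ∈ X, p' u = T (q u) := fun u hu ↦ by
    rcases eq_or_ne u w with rfl | huw
    · simp [hp']
    · rw [hp'_of_ne u huw, hTq u ⟨hu, huw⟩]
  have hp'X : IsRealizationOn d M X p' := fun u hu v hv ↦ by
    rw [hp'_eq u hu, hp'_eq v hv, hT.dist_eq, hq u hu v hv]
  have hwv : ∀ v, G.Adj w v → dist (p' w) (p' v) ^ 2 = M w v := fun v hadj ↦ by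
    by_cases hvX : v ∈ X
    · exact hp'X w hwX v hvX
    obtain ⟨i, hi⟩ := exists_disjoint_of_ncard_lt (Set.toFinite (Gᶜ.neighborSet v)) Xi hXidisj
      (by simpa using Nat.lt_succ_of_le (hdeg v))
    have hbv : ∀ b ∈ Xi i, G.Adj v b := fun b hb ↦ by
      by_contra hnadj
      have hvb : v ≠ b := fun hvb ↦ hvX (hvb ▸ hXisub i hb)
      exact Set.disjoint_left.1 hi hb ((G.compl_adj v b).2 ⟨hvb, hnadj⟩)
    have hsub : insert w (Xi i) ⊆ X := Set.insert_subset hwX (hXisub i)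
    refine dist_sq_eq_of_mem_affineSpan (hp'X.mono hsub) ?_ (fun b hb ↦ ?_) ?_ (B := Xi i)
    · obtain ⟨r, hr⟩ := hCv v hvX
      refine ⟨r, hr.mono (Set.insert_subset (by simp) fun b hb ↦ Or.inr ⟨?_, hsub hb⟩)⟩
      rcases hb with rfl | hb
      exacts [hadj.symm, hbv b hb]
    · have hbw : b ≠ w := fun hbw ↦ hwXi i (hbw ▸ hb)
      rw [hp'_of_ne b hbw, hp'_of_ne v hadj.ne']
      exact hp b hbw v hadj.ne' (hbv b hb).symm
    · exact ((hXibasis i).2.2 p' (hp'X.mono Set.sdiff_subset)).2 w ⟨hwX, by simp [hwXi]⟩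
  refine ⟨p', fun u _ v _ hadj ↦ ?_⟩
  rcases eq_or_ne u w with rfl | hu
  · exact hwv v hadj
  rcases eq_or_ne v w with rfl | hv
  · rw [dist_comm, hM.1 u v hadj]
    exact hwv u hadj.symm
  · rw [hp'_of_ne u hu, hp'_of_ne v hv]
    exact hp u hu v hv hadj
end

section
/- (Irrelevant-vertex form of the compression theorem for edge clique covers.) Let d ≥ 1 and k ≥ 1 be integers, let G be a graph on vertex set [n] that is not complete, let C₁,…,C_k be cliques of G covering every edge of G (for every edge {u,v} of G there is j with u,v ∈ C_j), and let M be a G-partial matrix. If n > (d+1)·k², then there exists a vertex w ∈ [n] such that M is d-completable if and only if M − w is d-completable. -/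
/-- Distances between affine combinations whose weights live on `T` depend only on the
distances between the points indexed by `T`. -/
theorem dist_affineCombination_eq_of_dist_eq {V E F : Type*} [Fintype V]
    [NormedAddCommGroup E] [InnerProductSpace ℝ E] [NormedAddCommGroup F]
    [InnerProductSpace ℝ F] {T : Set V} {q : V → E} {p : V → F}
    (h : ∀ u ∈ T, ∀ v ∈ T, dist (q u) (q v) = dist (p u) (p v)) {a b : V → ℝ}
    (ha : ∑ i, a i = 1) (hb : ∑ i, b i = 1) (haT : ∀ i ∉ T, a i = 0) (hbT : ∀ i ∉ T, b i = 0) :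
    dist (Finset.univ.affineCombination ℝ q a) (Finset.univ.affineCombination ℝ q b) =
      dist (Finset.univ.affineCombination ℝ p a) (Finset.univ.affineCombination ℝ p b) := by
  refine (mul_self_inj dist_nonneg dist_nonneg).1 ?_
  rw [EuclideanGeometry.dist_affineCombination q ha hb,
    EuclideanGeometry.dist_affineCombination p ha hb]
  congr 2
  refine Finset.sum_congr rfl fun i _ => Finset.sum_congr rfl fun j _ => ?_
  by_cases hi : i ∈ T
  · by_cases hj : j ∈ T
    · rw [h i hi j hj]
    · simp [haT j hj, hbT j hj]
  · simp [haT i hi, hbT i hi]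

/-- Every subfamily of points in a finite-dimensional real vector space has an indexed
affine spanning subset with at most `finrank + 1` elements. -/
theorem exists_finset_card_le_forall_mem_affineSpan {V E : Type*} [Finite V]
    [AddCommGroup E] [Module ℝ E] [FiniteDimensional ℝ E] (q : V → E) (S : Set V) :
    ∃ B : Finset V, (B : Set V) ⊆ S ∧ B.card ≤ Module.finrank ℝ E + 1 ∧
      ∀ v ∈ S, q v ∈ affineSpan ℝ (q '' B) := by
  classical
  obtain ⟨t, htS, hspan, hind⟩ := exists_affineIndependent ℝ E (q '' S)
  have htfin : t.Finite := (S.toFinite.image q).subset htS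
  obtain ⟨B, hBS, hinj, hBt⟩ := Finset.exists_subset_injOn_image_eq_of_surjOn
    S htfin.toFinset (f := q) (by simpa [Set.SurjOn] using htS)
  refine ⟨B, hBS, ?_, fun v hv => ?_⟩
  · rw [← Finset.card_image_of_injOn hinj, hBt]
    have := htfin.fintype
    have h := hind.card_le_finrank_succ.trans
      (Nat.add_le_add_right (Submodule.finrank_le _) 1)
    rwa [← Nat.card_eq_fintype_card, Nat.card_coe_set_eq,
      Set.ncard_eq_toFinset_card t htfin] at h
  · have hB : q '' B = t := by
      rw [← Finset.coe_image, hBt, htfin.coe_toFinset]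
    rw [hB, hspan]
    exact subset_affineSpan ℝ _ (Set.mem_image_of_mem q hv)

/-- A point of the affine span of `q '' B` is an affine combination of the whole family `q`
with weights supported on `B`. -/
theorem exists_weights_of_mem_affineSpan_image {V E : Type*} [Fintype V]
    [AddCommGroup E] [Module ℝ E] {q : V → E} {B : Set V} {x : E}
    (hx : x ∈ affineSpan ℝ (q '' B)) :
    ∃ c : V → ℝ, ∑ i, c i = 1 ∧ (∀ i ∉ B, c i = 0) ∧
      Finset.univ.affineCombination ℝ q c = x := by
  classical
  obtain ⟨s, c, hsB, hc, rfl⟩ := eq_affineCombination_of_mem_affineSpan_image hx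
  refine ⟨(s : Set V).indicator c, ?_, fun i hi => ?_, ?_⟩
  · rw [← hc]
    exact Finset.sum_indicator_subset c (Finset.subset_univ s)
  · exact Set.indicator_of_notMem (fun h => hi (hsB h)) c
  · exact (Finset.affineCombination_indicator_subset c q (Finset.subset_univ s)).symm

/-- Irrelevant-vertex form of the compression theorem for edge clique covers:
if `G` is not complete, its edges are covered by `k` cliques `C₁,…,C_k`, and
`n > (d+1)k²`, then some vertex `w` can be deleted from the `G`-partial matrix `M`
without changing `d`-completability. -/
theorem irrelevant_vertex_exists_cliqueCover {n : ℕ} (d k : ℕ) (hd : 1 ≤ d)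
    (hk : 1 ≤ k)
    (G : SimpleGraph (Fin n)) (hGnotcomplete : G ≠ ⊤)
    (C : Fin k → Set (Fin n)) (hC : ∀ j, G.IsClique (C j))
    (hcover : ∀ u v : Fin n, G.Adj u v → ∃ j, u ∈ C j ∧ v ∈ C j)
    (M : Fin n → Fin n → ℝ) (hM : IsPartialMatrix G M)
    (hn : (d + 1) * k ^ 2 < n) :
    ∃ w : Fin n, (IsCompletable d G M ↔ IsCompletableOn d G M {w}ᶜ) := by
  classical
  have restrict : ∀ w, IsCompletable d G M → IsCompletableOn d G M {w}ᶜ :=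
    fun w ⟨p, hp⟩ => ⟨p, fun u _ v _ => hp u trivial v trivial⟩
  have clique : ∀ (S : Set (Fin n)) (p : Fin n → EuclideanSpace ℝ (Fin d)),
      (∀ u ∈ S, ∀ v ∈ S, G.Adj u v → dist (p u) (p v) ^ 2 = M u v) →
      ∀ j, ∀ u ∈ C j ∩ S, ∀ v ∈ C j ∩ S, dist (p u) (p v) ^ 2 = M u v := by
    intro S p hp j u hu v hv
    rcases eq_or_ne u v with rfl | huv
    · simp [hM.2.2 u]
    · exact hp u hu.2 v hv.2 (hC j hu.1 hv.1 huv)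
  by_cases hemb : ∀ j, IsEmbeddableOn d M (C j)
  swap
  · -- A clique that is not embeddable misses a vertex, and obstructs both completions.
    push Not at hemb
    obtain ⟨j, hj⟩ := hemb
    obtain ⟨w, hw⟩ : ∃ w, w ∉ C j := by
      by_contra! h
      refine hGnotcomplete (eq_top_iff.2 fun u v huv => hC j (h u) (h v) huv)
    refine ⟨w, restrict w, fun ⟨p, hp⟩ => (hj ⟨p, fun u hu v hv => ?_⟩).elim⟩
    exact clique _ p hp j u ⟨hu, fun h => hw (h ▸ hu)⟩ v ⟨hv, fun h => hw (h ▸ hv)⟩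
  choose q hq using hemb
  choose B hBsub hBcard hBspan using fun j l =>
    exists_finset_card_le_forall_mem_affineSpan (q j) (C j ∩ C l)
  obtain ⟨w, hw⟩ : ∃ w, ∀ j l, w ∉ B j l := by
    by_contra! h
    have hcard := Finset.card_biUnion_le_card_mul Finset.univ
      (fun x : Fin k × Fin k => B x.1 x.2) (d + 1)
      fun x _ => by simpa using hBcard x.1 x.2
    have huniv : Finset.univ.biUnion (fun x : Fin k × Fin k => B x.1 x.2) = Finset.univ :=
      Finset.eq_univ_iff_forall.2 fun w => by simpa using h w
    rw [huniv] at hcard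
    simp only [Finset.card_univ, Fintype.card_prod, Fintype.card_fin] at hcard
    nlinarith
  refine ⟨w, restrict w, fun ⟨p, hp⟩ => ?_⟩
  have weights : ∀ j l, ∃ c : Fin n → ℝ, w ∈ C j ∩ C l → ∑ i, c i = 1 ∧
      (∀ i ∉ (B j l : Set (Fin n)), c i = 0) ∧
      Finset.univ.affineCombination ℝ (q j) c = q j w := by
    intro j l
    by_cases hjl : w ∈ C j ∩ C l
    · obtain ⟨c, hc⟩ := exists_weights_of_mem_affineSpan_image (hBspan j l w hjl)
      exact ⟨c, fun _ => hc⟩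
    · exact ⟨0, fun h => (hjl h).elim⟩
  choose c hc using weights
  have hcsum : ∀ {j l}, w ∈ C j → w ∈ C l → ∑ i, c j l i = 1 :=
    fun hj hl => (hc _ _ ⟨hj, hl⟩).1
  have hceq : ∀ {j l}, w ∈ C j → w ∈ C l →
      Finset.univ.affineCombination ℝ (q j) (c j l) = q j w :=
    fun hj hl => (hc _ _ ⟨hj, hl⟩).2.2
  have hcsupp : ∀ {j l}, w ∈ C j → w ∈ C l → ∀ i ∉ C j ∩ C l ∩ {w}ᶜ, c j l i = 0 :=
    fun {j l} hj hl i hi => (hc j l ⟨hj, hl⟩).2.1 i fun hiB =>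
      hi ⟨hBsub j l hiB, fun h => hw j l (Set.mem_singleton_iff.1 h ▸ hiB)⟩
  have hsingle : ∀ u : Fin n, ∑ i, (Pi.single u 1 : Fin n → ℝ) i = 1 := by simp
  have hsingle_supp : ∀ {T : Set (Fin n)} {u : Fin n}, u ∈ T →
      ∀ i ∉ T, (Pi.single u 1 : Fin n → ℝ) i = 0 :=
    fun hu i hi => Pi.single_eq_of_ne (ne_of_mem_of_not_mem hu hi).symm _
  have hqq : ∀ j l, ∀ u ∈ C j ∩ C l, ∀ v ∈ C j ∩ C l,
      dist (q j u) (q j v) = dist (q l u) (q l v) := fun j l u hu v hv =>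
    (sq_eq_sq₀ dist_nonneg dist_nonneg).1
      ((hq j u hu.1 v hv.1).trans (hq l u hu.2 v hv.2).symm)
  have hqp : ∀ j, ∀ u ∈ C j ∩ {w}ᶜ, ∀ v ∈ C j ∩ {w}ᶜ,
      dist (q j u) (q j v) = dist (p u) (p v) := fun j u hu v hv =>
    (sq_eq_sq₀ dist_nonneg dist_nonneg).1
      ((hq j u hu.1 v hv.1).trans (clique _ p hp j u hu v hv).symm)
  have hceq' : ∀ {j l}, w ∈ C j → w ∈ C l →
      Finset.univ.affineCombination ℝ (q l) (c j l) = q l w := by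
    intro j l hj hl
    have h := dist_affineCombination_eq_of_dist_eq (hqq j l) (hcsum hj hl) (hsingle w)
      (fun i hi => hcsupp hj hl i fun h => hi h.1) (hsingle_supp ⟨hj, hl⟩)
    simp only [Finset.univ.affineCombination_piSingle ℝ _ (Finset.mem_univ w)] at h
    rw [hceq hj hl, dist_self] at h
    exact dist_eq_zero.1 h.symm
  -- All the candidate positions of `w` prescribed by the cliques containing it agree.
  have agree : ∀ {j l}, w ∈ C j → w ∈ C l →
      Finset.univ.affineCombination ℝ p (c j j) = Finset.univ.affineCombination ℝ p (c l l) := by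
    intro j l hj hl
    have h1 := dist_affineCombination_eq_of_dist_eq (hqp j) (hcsum hj hj) (hcsum hj hl)
      (fun i hi => hcsupp hj hj i fun h => hi ⟨h.1.1, h.2⟩)
      (fun i hi => hcsupp hj hl i fun h => hi ⟨h.1.1, h.2⟩)
    have h2 := dist_affineCombination_eq_of_dist_eq (hqp l) (hcsum hj hl) (hcsum hl hl)
      (fun i hi => hcsupp hj hl i fun h => hi ⟨h.1.2, h.2⟩)
      (fun i hi => hcsupp hl hl i fun h => hi ⟨h.1.1, h.2⟩)
    rw [hceq hj hj, hceq hj hl, dist_self] at h1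
    rw [hceq' hj hl, hceq hl hl, dist_self] at h2
    exact (dist_eq_zero.1 h1.symm).trans (dist_eq_zero.1 h2.symm)
  obtain ⟨x, hx⟩ : ∃ x, ∀ j, w ∈ C j → Finset.univ.affineCombination ℝ p (c j j) = x := by
    by_cases h : ∃ j, w ∈ C j
    · obtain ⟨j, hj⟩ := h
      exact ⟨_, fun l hl => agree hl hj⟩
    · exact ⟨0, fun j hj => (h ⟨j, hj⟩).elim⟩
  have hdist : ∀ u, G.Adj w u → dist x (p u) ^ 2 = M w u := by
    intro u hwu
    obtain ⟨j, hj, hu⟩ := hcover w u hwu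
    have huw : u ∈ C j ∩ {w}ᶜ := ⟨hu, hwu.ne'⟩
    have h := dist_affineCombination_eq_of_dist_eq (hqp j) (hcsum hj hj) (hsingle u)
      (fun i hi => hcsupp hj hj i fun h => hi ⟨h.1.1, h.2⟩) (hsingle_supp huw)
    simp only [Finset.univ.affineCombination_piSingle ℝ _ (Finset.mem_univ u)] at h
    rw [hceq hj hj, hx j hj] at h
    rw [← h]
    exact hq j w hj u hu
  refine ⟨Function.update p w x, fun u _ v _ huv => ?_⟩
  rcases eq_or_ne u w with rfl | hu
  · rw [Function.update_self, Function.update_of_ne huv.ne']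
    exact hdist v huv
  · rcases eq_or_ne v w with rfl | hv
    · rw [Function.update_self, Function.update_of_ne hu, dist_comm, hM.1 u v huv]
      exact hdist u huv.symm
    · rw [Function.update_of_ne hu, Function.update_of_ne hv]
      exact hp u hu v hv huv
end
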